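/- (Direct part of Stein's lemma.) For every ε with 0 < ε < 1, limsup_{n→∞} (1/n) log β*_n(ε) ≤ −D(ρ‖σ). -/

import Mathlib

open Matrix Filter
open scoped ComplexOrder

noncomputable section

/-- Functional calculus for a Hermitian matrix: apply `f` to the eigenvalues. -/
def matFun {m : Type*} [Fintype m] [DecidableEq m] (f : ℝ → ℝ) (A : Matrix m m ℂ) :
    Matrix m m ℂ :=
  if hA : A.IsHermitian then
    (hA.eigenvectorUnitary : Matrix m m ℂ) *
      Matrix.diagonal (fun i => (f (hA.eigenvalues i) : ℂ)) *
      star (hA.eigenvectorUnitary : Matrix m m ℂ)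
  else 0

/-- Matrix logarithm (via functional calculus). -/
def matLog {m : Type*} [Fintype m] [DecidableEq m] (A : Matrix m m ℂ) : Matrix m m ℂ :=
  matFun Real.log A

/-- Real matrix power (via functional calculus). -/
def matRPow {m : Type*} [Fintype m] [DecidableEq m] (A : Matrix m m ℂ) (s : ℝ) :
    Matrix m m ℂ :=
  matFun (fun x => x ^ s) A

open Classical in
/-- The finite set of (distinct, real) eigenvalues of a Hermitian matrix. -/
def eigFinset {m : Type*} [Fintype m] [DecidableEq m] (A : Matrix m m ℂ) : Finset ℝ :=
  if hA : A.IsHermitian then Finset.image hA.eigenvalues Finset.univ else ∅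

/-- `v A`: the number of distinct eigenvalues of a Hermitian matrix `A`. -/
def numEig {m : Type*} [Fintype m] [DecidableEq m] (A : Matrix m m ℂ) : ℕ :=
  (eigFinset A).card

/-- The spectral projection of a Hermitian matrix `A` corresponding to eigenvalue `μ`. -/
def specProj {m : Type*} [Fintype m] [DecidableEq m] (A : Matrix m m ℂ) (μ : ℝ) :
    Matrix m m ℂ :=
  matFun (fun x => if x = μ then 1 else 0) A

/-- The pinching `E_A(B) = Σ_i E_i B E_i` of `B` by the Hermitian matrix `A`. -/
def pinch {m : Type*} [Fintype m] [DecidableEq m] (A B : Matrix m m ℂ) : Matrix m m ℂ :=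
  ∑ μ ∈ eigFinset A, specProj A μ * B * specProj A μ

/-- `{X > 0}`: the projection onto the strictly positive eigenspaces of a Hermitian `X`. -/
def posProj {m : Type*} [Fintype m] [DecidableEq m] (X : Matrix m m ℂ) : Matrix m m ℂ :=
  matFun (fun x => if 0 < x then 1 else 0) X

/-- The `n`-fold tensor (Kronecker) power of a `d × d` matrix, realized on the index type
`Fin n → Fin d`. -/
def tensorPow {d : ℕ} (ρ : Matrix (Fin d) (Fin d) ℂ) (n : ℕ) :
    Matrix (Fin n → Fin d) (Fin n → Fin d) ℂ :=
  fun x y => ∏ i, ρ (x i) (y i)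

/-- A density matrix: positive semidefinite with unit trace. -/
def IsDensity {m : Type*} [Fintype m] [DecidableEq m] (ρ : Matrix m m ℂ) : Prop :=
  ρ.PosSemidef ∧ ρ.trace = 1

/-- A test: an operator `A` with `0 ≤ A ≤ I` in the Loewner order. -/
def IsTest {m : Type*} [Fintype m] [DecidableEq m] (A : Matrix m m ℂ) : Prop :=
  A.PosSemidef ∧ (1 - A).PosSemidef

/-- The quantum relative entropy `D(ρ‖σ) = Tr[ρ (log ρ − log σ)]`. -/
def relEnt {m : Type*} [Fintype m] [DecidableEq m] (ρ σ : Matrix m m ℂ) : ℝ :=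
  ((ρ * (matLog ρ - matLog σ)).trace).re

/-- The error probability of the first kind, `α_n(A) = Tr[ρ_n (I − A)]`. -/
def alphaErr {d : ℕ} (ρ : Matrix (Fin d) (Fin d) ℂ) (n : ℕ)
    (A : Matrix (Fin n → Fin d) (Fin n → Fin d) ℂ) : ℝ :=
  ((tensorPow ρ n * (1 - A)).trace).re

/-- The error probability of the second kind, `β_n(A) = Tr[σ_n A]`. -/
def betaErr {d : ℕ} (σ : Matrix (Fin d) (Fin d) ℂ) (n : ℕ)
    (A : Matrix (Fin n → Fin d) (Fin n → Fin d) ℂ) : ℝ :=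
  ((tensorPow σ n * A).trace).re

/-- `β*_n(ε)`: the minimum type-II error among tests with type-I error at most `ε`. -/
def betaStar {d : ℕ} (ρ σ : Matrix (Fin d) (Fin d) ℂ) (n : ℕ) (ε : ℝ) : ℝ :=
  sInf {b : ℝ | ∃ A : Matrix (Fin n → Fin d) (Fin n → Fin d) ℂ,
    IsTest A ∧ alphaErr ρ n A ≤ ε ∧ b = betaErr σ n A}


/-- `W diag(f) W*`. -/
def cj {m : Type*} [Fintype m] [DecidableEq m] (W : Matrix m m ℂ) (f : m → ℝ) : Matrix m m ℂ :=
  W * Matrix.diagonal (fun i => (f i : ℂ)) * star W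

section aux
variable {m : Type*} [Fintype m] [DecidableEq m]

lemma cj_mul {W : Matrix m m ℂ} (h : star W * W = 1) (f g : m → ℝ) :
    cj W f * cj W g = cj W (fun i => f i * g i) := by
  unfold cj
  calc _ = W * Matrix.diagonal (fun i => (f i : ℂ)) * (star W * W) *
        Matrix.diagonal (fun i => (g i : ℂ)) * star W := by simp only [Matrix.mul_assoc]
    _ = _ := by
        rw [h, Matrix.mul_one, Matrix.mul_assoc W, Matrix.diagonal_mul_diagonal]
        simp

lemma cj_const {W : Matrix m m ℂ} (h : W * star W = 1) (c : ℝ) :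
    cj W (fun _ => c) = (c : ℂ) • 1 := by
  unfold cj
  rw [← Matrix.smul_one_eq_diagonal]
  simp [h]

lemma cj_sub (W : Matrix m m ℂ) (f g : m → ℝ) :
    cj W f - cj W g = cj W (fun i => f i - g i) := by
  unfold cj
  rw [← Matrix.sub_mul, ← Matrix.mul_sub, Matrix.diagonal_sub]
  simp

lemma cj_one_sub {W : Matrix m m ℂ} (h : W * star W = 1) (f : m → ℝ) :
    1 - cj W f = cj W (fun i => 1 - f i) := by
  rw [← cj_sub, cj_const h]; simp

lemma cj_trace {W : Matrix m m ℂ} (h : star W * W = 1) (f : m → ℝ) :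
    (cj W f).trace.re = ∑ i, f i := by
  unfold cj
  rw [Matrix.trace_mul_comm, ← Matrix.mul_assoc, h, Matrix.one_mul, Matrix.trace_diagonal]
  simp

lemma cj_psd (W : Matrix m m ℂ) {f : m → ℝ} (hf : ∀ i, 0 ≤ f i) : (cj W f).PosSemidef := by
  unfold cj
  refine Matrix.PosSemidef.mul_mul_conjTranspose_same (Matrix.PosSemidef.diagonal ?_) W
  intro i
  simpa using hf i

lemma cj_star (W : Matrix m m ℂ) (f : m → ℝ) : (cj W f)ᴴ = cj W f := by
  unfold cj
  rw [Matrix.star_eq_conjTranspose, Matrix.conjTranspose_mul, Matrix.conjTranspose_mul,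
    Matrix.diagonal_conjTranspose, Matrix.conjTranspose_conjTranspose, Matrix.mul_assoc]
  congr 3
  ext i
  simp

lemma matFun_eq {A : Matrix m m ℂ} (hA : A.IsHermitian) (f : ℝ → ℝ) :
    matFun f A = cj (hA.eigenvectorUnitary : Matrix m m ℂ) (fun i => f (hA.eigenvalues i)) := by
  unfold matFun cj
  rw [dif_pos hA]

lemma self_eq_cj {A : Matrix m m ℂ} (hA : A.IsHermitian) :
    A = cj (hA.eigenvectorUnitary : Matrix m m ℂ) hA.eigenvalues := by
  have := hA.spectral_theorem
  rw [Unitary.conjStarAlgAut_apply] at this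
  exact this

/-- outcome distribution of `ρ` in basis `V` -/
def qd (ρ V : Matrix m m ℂ) (x : m) : ℝ := ((star V * ρ * V) x x).re

lemma qd_diag_nonneg {ρ : Matrix m m ℂ} (hρ : ρ.PosSemidef) (V : Matrix m m ℂ) (x : m) :
    0 ≤ (star V * ρ * V) x x := by
  exact (hρ.conjTranspose_mul_mul_same V).diag_nonneg

lemma qd_nonneg {ρ : Matrix m m ℂ} (hρ : ρ.PosSemidef) (V : Matrix m m ℂ) (x : m) :
    0 ≤ qd ρ V x := (Complex.le_def.mp (qd_diag_nonneg hρ V x)).1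

lemma qd_ofReal {ρ : Matrix m m ℂ} (hρ : ρ.PosSemidef) (V : Matrix m m ℂ) (x : m) :
    (star V * ρ * V) x x = (qd ρ V x : ℂ) := by
  apply Complex.ext
  · simp [qd]
  · simpa using (Complex.le_def.mp (qd_diag_nonneg hρ V x)).2.symm

lemma trace_mul_cj_complex (ρ V : Matrix m m ℂ) (f : m → ℝ) :
    (ρ * cj V f).trace = ∑ x, (star V * ρ * V) x x * (f x : ℂ) := by
  unfold cj
  rw [← Matrix.mul_assoc, Matrix.trace_mul_comm, ← Matrix.mul_assoc, ← Matrix.mul_assoc,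
    Matrix.trace]
  simp [Matrix.mul_diagonal]

lemma trace_mul_cj {ρ : Matrix m m ℂ} (hρ : ρ.PosSemidef) (V : Matrix m m ℂ) (f : m → ℝ) :
    (ρ * cj V f).trace.re = ∑ x, qd ρ V x * f x := by
  rw [trace_mul_cj_complex]
  simp_rw [qd_ofReal hρ]
  simp

lemma trace_psd_mul {A B : Matrix m m ℂ} (hA : A.PosSemidef) (hB : B.PosSemidef) :
    0 ≤ (A * B).trace.re := by
  rw [self_eq_cj hB.1, trace_mul_cj hA]
  exact Finset.sum_nonneg fun x _ => mul_nonneg (qd_nonneg hA _ _) (hB.eigenvalues_nonneg x)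

lemma cj_trace_mono {W : Matrix m m ℂ} {f g : m → ℝ} (hfg : ∀ i, f i ≤ g i)
    {A : Matrix m m ℂ} (hA : A.PosSemidef) :
    (cj W f * A).trace.re ≤ (cj W g * A).trace.re := by
  have h := trace_psd_mul (cj_psd W (f := fun i => g i - f i)
    (fun i => sub_nonneg.mpr (hfg i))) hA
  rw [← cj_sub, Matrix.sub_mul, Matrix.trace_sub, Complex.sub_re] at h
  linarith

lemma qd_sum {ρ : Matrix m m ℂ} (hρ : IsDensity ρ) {V : Matrix m m ℂ} (h : V * star V = 1) :
    ∑ x, qd ρ V x = 1 := by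
  have h1 := trace_mul_cj hρ.1 V (fun _ => 1)
  rw [cj_const h] at h1
  simp [hρ.2] at h1
  exact h1.symm

end aux

section tens
variable {d : ℕ}

lemma tp_mul (A B : Matrix (Fin d) (Fin d) ℂ) (n : ℕ) :
    tensorPow (A * B) n = tensorPow A n * tensorPow B n := by
  ext x y
  simp only [tensorPow, Matrix.mul_apply]
  rw [Finset.prod_univ_sum, Fintype.piFinset_univ]
  simp only [Finset.prod_mul_distrib]

lemma tp_star (A : Matrix (Fin d) (Fin d) ℂ) (n : ℕ) :
    tensorPow (star A) n = star (tensorPow A n) := by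
  ext x y
  simp [tensorPow, Matrix.star_apply]

lemma tp_diag (f : Fin d → ℂ) (n : ℕ) :
    tensorPow (Matrix.diagonal f) n = Matrix.diagonal (fun x => ∏ i, f (x i)) := by
  ext x y
  simp only [tensorPow, Matrix.diagonal_apply]
  split_ifs with h
  · subst h; simp
  · obtain ⟨i, hi⟩ := Function.ne_iff.mp h
    exact Finset.prod_eq_zero (Finset.mem_univ i) (by simp [hi])

lemma tp_one (n : ℕ) : tensorPow (1 : Matrix (Fin d) (Fin d) ℂ) n = 1 := by
  rw [← Matrix.diagonal_one, tp_diag]; simp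

lemma tp_cj (W : Matrix (Fin d) (Fin d) ℂ) (f : Fin d → ℝ) (n : ℕ) :
    tensorPow (cj W f) n = cj (tensorPow W n) (fun x => ∏ i, f (x i)) := by
  unfold cj
  rw [tp_mul, tp_mul, tp_star, tp_diag]
  simp

lemma tp_unit {W : Matrix (Fin d) (Fin d) ℂ} (h : star W * W = 1) (n : ℕ) :
    star (tensorPow W n) * tensorPow W n = 1 := by
  rw [← tp_star, ← tp_mul, h, tp_one]

lemma tp_unit2 {W : Matrix (Fin d) (Fin d) ℂ} (h : W * star W = 1) (n : ℕ) :
    tensorPow W n * star (tensorPow W n) = 1 := by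
  rw [← tp_star, ← tp_mul, h, tp_one]

lemma tp_psd {ρ : Matrix (Fin d) (Fin d) ℂ} (hρ : ρ.PosSemidef) (n : ℕ) :
    (tensorPow ρ n).PosSemidef := by
  rw [self_eq_cj hρ.1, tp_cj]
  exact cj_psd _ (fun x => Finset.prod_nonneg fun i _ => hρ.eigenvalues_nonneg _)

lemma tp_trace (ρ : Matrix (Fin d) (Fin d) ℂ) (n : ℕ) :
    (tensorPow ρ n).trace = ρ.trace ^ n := by
  simp only [Matrix.trace, Matrix.diag, tensorPow]
  have h := Finset.prod_univ_sum (fun _ : Fin n => (Finset.univ : Finset (Fin d)))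
    (fun _ a => ρ a a)
  rw [Fintype.piFinset_univ] at h
  rw [← h]
  simp

lemma tp_qd {ρ : Matrix (Fin d) (Fin d) ℂ} (hρ : ρ.PosSemidef) (V : Matrix (Fin d) (Fin d) ℂ)
    (n : ℕ) (x : Fin n → Fin d) :
    qd (tensorPow ρ n) (tensorPow V n) x = ∏ i, qd ρ V (x i) := by
  have h : (star (tensorPow V n) * tensorPow ρ n * tensorPow V n) x x
      = ∏ i, (star V * ρ * V) (x i) (x i) := by
    rw [← tp_star, ← tp_mul, ← tp_mul]; rfl
  rw [qd, h]
  simp_rw [qd_ofReal hρ]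
  rw [← Complex.ofReal_prod, Complex.ofReal_re]

lemma sum_prod_pow {n : ℕ} (q : Fin d → ℝ) :
    ∑ x : Fin n → Fin d, ∏ i, q (x i) = (∑ a, q a) ^ n := by
  rw [← Fintype.piFinset_univ, ← Finset.prod_univ_sum]
  simp

/-- Chernoff bound. -/
lemma chernoff (q g : Fin d → ℝ) (hq : ∀ a, 0 ≤ q a) (hq1 : ∑ a, q a = 1) (c : ℝ)
    (hc : ∑ a, q a * g a < c) (η : ℝ) (hη : 0 < η) :
    ∀ᶠ n : ℕ in atTop, ∑ x : Fin n → Fin d, (∏ i, q (x i)) *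
      (1 - if ∑ i, g (x i) ≤ n * c then 1 else 0) ≤ η := by
  set M : ℝ → ℝ := fun t => ∑ a, q a * Real.exp (t * (g a - c)) with hM
  have hder : HasDerivAt M (∑ a, q a * (g a - c)) 0 := by
    have : ∀ a ∈ Finset.univ, HasDerivAt (fun t : ℝ => q a * Real.exp (t * (g a - c)))
        (q a * (g a - c)) 0 := by
      intro a _
      have h := (((hasDerivAt_id (0 : ℝ)).mul_const (g a - c)).exp).const_mul (q a)
      simpa using h
    exact HasDerivAt.fun_sum this
  have hneg : ∑ a, q a * (g a - c) < 0 := by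
    have : ∑ a, q a * (g a - c) = ∑ a, q a * g a - c := by
      simp only [mul_sub, Finset.sum_sub_distrib, ← Finset.sum_mul, hq1, one_mul]
    linarith
  have hM0 : M 0 = 1 := by simp [hM, hq1]
  obtain ⟨t, ht, hMt⟩ : ∃ t : ℝ, 0 < t ∧ M t < 1 := by
    have h := hasDerivWithinAt_iff_tendsto_slope.mp (hder.hasDerivWithinAt (s := Set.Ioi 0))
    have h2 : ∀ᶠ t in nhdsWithin (0:ℝ) (Set.Ioi 0 \ {0}), slope M 0 t < 0 :=
      h.eventually (gt_mem_nhds hneg)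
    have e : Set.Ioi (0:ℝ) \ {0} = Set.Ioi 0 := by simp
    rw [e] at h2
    obtain ⟨t, h3, h4⟩ := (h2.and self_mem_nhdsWithin).exists
    refine ⟨t, h4, ?_⟩
    rw [slope_def_field, hM0, sub_zero] at h3
    have h4' : 0 < t := h4
    rw [div_lt_iff₀ h4'] at h3
    linarith
  have hMnn : 0 ≤ M t := Finset.sum_nonneg fun a _ => mul_nonneg (hq a) (Real.exp_pos _).le
  have hlim := tendsto_pow_atTop_nhds_zero_of_lt_one hMnn hMt
  filter_upwards [hlim.eventually (gt_mem_nhds hη)] with n hn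
  refine le_trans ?_ hn.le
  simp only [hM]
  rw [← sum_prod_pow]
  refine Finset.sum_le_sum fun x _ => ?_
  rw [Finset.prod_mul_distrib]
  refine mul_le_mul_of_nonneg_left ?_ (Finset.prod_nonneg fun i _ => hq _)
  rw [← Real.exp_sum]
  split_ifs with h
  · simpa using (Real.exp_pos _).le
  · rw [sub_zero]
    apply Real.one_le_exp
    rw [← Finset.mul_sum, Finset.sum_sub_distrib]
    push Not at h
    simp only [Finset.sum_const, Finset.card_univ, Fintype.card_fin, nsmul_eq_mul]
    exact mul_nonneg ht.le (by linarith)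

end tens

lemma test_ineq {m : Type*} [Fintype m] [DecidableEq m] {P Q : Matrix m m ℂ}
    (hP : P.PosSemidef) (hP1 : (1 - P).PosSemidef) (hQ : Q.PosSemidef)
    (hQ1 : (1 - Q).PosSemidef) (hQQ : Q * Q = Q) :
    IsTest (Q * P * Q) ∧
    ((1 - P) + (1 - P) + ((1 - Q) + (1 - Q) + (1 - Q)) - (1 - Q * P * Q)).PosSemidef := by
  have hQs : Qᴴ = Q := hQ.1
  have h1 : (Q * P * Q).PosSemidef := by
    have := hP.mul_mul_conjTranspose_same Q
    rwa [hQs] at this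
  have h2 : (Q * (1 - P) * Q).PosSemidef := by
    have := hP1.mul_mul_conjTranspose_same Q
    rwa [hQs] at this
  refine ⟨⟨h1, ?_⟩, ?_⟩
  · have : 1 - Q * P * Q = (1 - Q) + Q * (1 - P) * Q := by
      rw [Matrix.mul_sub, Matrix.sub_mul, Matrix.mul_one, hQQ]; abel
    rw [this]
    exact hQ1.add h2
  · have h3 := hP1.mul_mul_conjTranspose_same (1 + (1 - Q))
    have h4 := hP.mul_mul_conjTranspose_same (1 - Q)
    have e1 : (1 - Q)ᴴ = 1 - Q := hQ1.1
    have e2 : (1 + (1 - Q))ᴴ = 1 + (1 - Q) := by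
      rw [Matrix.conjTranspose_add, e1, Matrix.conjTranspose_one]
    rw [e1] at h4
    rw [e2] at h3
    convert (h3.add h4).add h4 using 1
    have e3 : (1 + (1 - Q)) * (1 - P) * (1 + (1 - Q)) + (1 - Q) * P * (1 - Q)
        + (1 - Q) * P * (1 - Q) = 4 • (1 : Matrix m m ℂ) - 4 • Q + Q * Q - 2 • P + Q * P * Q := by
      noncomm_ring
    rw [e3, hQQ]
    noncomm_ring

/-- lower bound on the type II error -/
lemma betaErr_lower {d : ℕ} {ρ σ : Matrix (Fin d) (Fin d) ℂ}
    (hρ : IsDensity ρ) (hσpd : σ.PosDef) :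
    ∃ l : ℝ, 0 < l ∧ ∀ (n : ℕ) (ε : ℝ) (A : Matrix (Fin n → Fin d) (Fin n → Fin d) ℂ),
      IsTest A → alphaErr ρ n A ≤ ε → l ^ n * (1 - ε) ≤ betaErr σ n A := by
  obtain ⟨l, hl, hle⟩ : ∃ l : ℝ, 0 < l ∧ ∀ i, l ≤ hσpd.1.eigenvalues i := by
    rcases isEmpty_or_nonempty (Fin d) with h | h
    · exact ⟨1, one_pos, fun i => h.elim i⟩
    · obtain ⟨i, hi⟩ := Finite.exists_min hσpd.1.eigenvalues
      exact ⟨_, hσpd.eigenvalues_pos i, hi⟩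
  have hr1 : ∀ i, hρ.1.1.eigenvalues i ≤ 1 := by
    intro i
    have h := hρ.1.1.trace_eq_sum_eigenvalues
    have h' : ∑ i, hρ.1.1.eigenvalues i = 1 := by
      have := congrArg Complex.re (hρ.2.symm.trans h)
      simpa using this.symm
    rw [← h']
    exact Finset.single_le_sum (fun j _ => hρ.1.eigenvalues_nonneg j) (Finset.mem_univ i)
  refine ⟨l, hl, fun n ε A hA hα => ?_⟩
  have hU2 := Unitary.mul_star_self_of_mem hρ.1.1.eigenvectorUnitary.2
  have hV2 := Unitary.mul_star_self_of_mem hσpd.1.eigenvectorUnitary.2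
  have b1 : l ^ n * A.trace.re ≤ betaErr σ n A := by
    have := cj_trace_mono (W := tensorPow (hσpd.1.eigenvectorUnitary : Matrix _ _ ℂ) n)
      (f := fun _ => l ^ n) (g := fun x => ∏ i, hσpd.1.eigenvalues (x i)) ?_ hA.1
    · rw [← tp_cj, ← self_eq_cj, cj_const (tp_unit2 hV2 n)] at this
      unfold betaErr
      refine le_trans (le_of_eq ?_) this
      rw [Matrix.smul_mul, Matrix.trace_smul, smul_eq_mul, Complex.re_ofReal_mul, Matrix.one_mul]
    · intro x
      have := Finset.prod_le_prod (s := Finset.univ) (f := fun _ : Fin n => l)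
        (g := fun i => hσpd.1.eigenvalues (x i)) (fun _ _ => hl.le) (fun i _ => hle _)
      simpa using this
  have b2 : 1 - ε ≤ A.trace.re := by
    have := cj_trace_mono (W := tensorPow (hρ.1.1.eigenvectorUnitary : Matrix _ _ ℂ) n)
      (f := fun x => ∏ i, hρ.1.1.eigenvalues (x i)) (g := fun _ => 1) ?_ hA.1
    · rw [← tp_cj, ← self_eq_cj, cj_const (tp_unit2 hU2 n)] at this
      unfold alphaErr at hα
      rw [Matrix.mul_sub, Matrix.trace_sub, Matrix.mul_one, tp_trace, hρ.2] at hα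
      simp at hα this
      linarith
    · intro x
      exact Finset.prod_le_one (fun i _ => hρ.1.eigenvalues_nonneg _) (fun i _ => hr1 _)
  exact le_trans (mul_le_mul_of_nonneg_left b2 (by positivity)) b1

lemma exists_test {d : ℕ} {ρ σ : Matrix (Fin d) (Fin d) ℂ}
    (hρ : IsDensity ρ) (hρpd : ρ.PosDef) (hσpd : σ.PosDef)
    (ε : ℝ) (hε0 : 0 < ε) (δ : ℝ) (hδ : 0 < δ) :
    ∀ᶠ n : ℕ in atTop, ∃ A : Matrix (Fin n → Fin d) (Fin n → Fin d) ℂ,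
      IsTest A ∧ alphaErr ρ n A ≤ ε ∧ betaErr σ n A ≤ Real.exp (n * (-relEnt ρ σ + 2 * δ)) := by
  have hρe := self_eq_cj hρpd.1
  have hσe := self_eq_cj hσpd.1
  have hLρ : matLog ρ = _ := matFun_eq hρpd.1 Real.log
  have hLσ : matLog σ = _ := matFun_eq hσpd.1 Real.log
  have hrpos := hρpd.eigenvalues_pos
  have hspos := hσpd.eigenvalues_pos
  have hrsum : ∑ i, hρpd.1.eigenvalues i = 1 := by
    have h := hρpd.1.trace_eq_sum_eigenvalues
    rw [hρ.2] at h
    have := congrArg Complex.re h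
    simpa using this.symm
  have hU1 := Unitary.star_mul_self_of_mem hρpd.1.eigenvectorUnitary.2
  have hU2 := Unitary.mul_star_self_of_mem hρpd.1.eigenvectorUnitary.2
  have hV1 := Unitary.star_mul_self_of_mem hσpd.1.eigenvectorUnitary.2
  have hV2 := Unitary.mul_star_self_of_mem hσpd.1.eigenvectorUnitary.2
  generalize (hρpd.1.eigenvectorUnitary : Matrix (Fin d) (Fin d) ℂ) = U at *
  generalize (hσpd.1.eigenvectorUnitary : Matrix (Fin d) (Fin d) ℂ) = V at *
  generalize hρpd.1.eigenvalues = r at *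
  generalize hσpd.1.eigenvalues = s at *
  have hD : relEnt ρ σ = ∑ x, qd ρ U x * Real.log (r x) - ∑ x, qd ρ V x * Real.log (s x) := by
    unfold relEnt
    rw [hLρ, hLσ, Matrix.mul_sub, Matrix.trace_sub, Complex.sub_re, trace_mul_cj hρ.1,
      trace_mul_cj hρ.1]
  set a := ∑ x, qd ρ U x * Real.log (r x) with ha
  set b := ∑ x, qd ρ V x * Real.log (s x) with hb
  have c1 := chernoff (qd ρ U) (fun x => -Real.log (r x)) (qd_nonneg hρ.1 U) (qd_sum hρ hU2)
    (-a + δ) (by simp only [mul_neg, Finset.sum_neg_distrib]; linarith) (ε / 5) (by positivity)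
  have c2 := chernoff (qd ρ V) (fun x => Real.log (s x)) (qd_nonneg hρ.1 V) (qd_sum hρ hV2)
    (b + δ) (by linarith) (ε / 5) (by positivity)
  filter_upwards [c1, c2] with n h1 h2
  set fP : (Fin n → Fin d) → ℝ := fun x =>
    if ∑ i, -Real.log (r (x i)) ≤ n * (-a + δ) then 1 else 0 with hfP
  set fQ : (Fin n → Fin d) → ℝ := fun x =>
    if ∑ i, Real.log (s (x i)) ≤ n * (b + δ) then 1 else 0 with hfQ
  have fP0 : ∀ x, 0 ≤ fP x := fun x => by simp only [hfP]; split_ifs <;> norm_num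
  have fP1 : ∀ x, 0 ≤ 1 - fP x := fun x => by simp only [hfP]; split_ifs <;> norm_num
  have fQ0 : ∀ x, 0 ≤ fQ x := fun x => by simp only [hfQ]; split_ifs <;> norm_num
  have fQ1 : ∀ x, 0 ≤ 1 - fQ x := fun x => by simp only [hfQ]; split_ifs <;> norm_num
  have fQQ : ∀ x, fQ x * fQ x = fQ x := fun x => by simp only [hfQ]; split_ifs <;> norm_num
  set P := cj (tensorPow U n) fP with hP
  set Q := cj (tensorPow V n) fQ with hQ
  have eP : 1 - P = cj (tensorPow U n) (fun x => 1 - fP x) := cj_one_sub (tp_unit2 hU2 n) _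
  have eQ : 1 - Q = cj (tensorPow V n) (fun x => 1 - fQ x) := cj_one_sub (tp_unit2 hV2 n) _
  have hPp : P.PosSemidef := cj_psd _ fP0
  have hQp : Q.PosSemidef := cj_psd _ fQ0
  obtain ⟨hT, hI⟩ := test_ineq (P := P) (Q := Q) hPp (eP ▸ cj_psd _ fP1)
    hQp (eQ ▸ cj_psd _ fQ1) (by rw [hQ, cj_mul (tp_unit hV1 n)]; simp only [fQQ])
  refine ⟨Q * P * Q, hT, ?_, ?_⟩
  · have t1 : (tensorPow ρ n * (1 - P)).trace.re ≤ ε / 5 := by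
      rw [eP, trace_mul_cj (tp_psd hρ.1 n)]
      simp_rw [tp_qd hρ.1]
      exact h1
    have t2 : (tensorPow ρ n * (1 - Q)).trace.re ≤ ε / 5 := by
      rw [eQ, trace_mul_cj (tp_psd hρ.1 n)]
      simp_rw [tp_qd hρ.1]
      exact h2
    have t3 := trace_psd_mul (tp_psd hρ.1 n) hI
    rw [Matrix.mul_sub _ _ (1 - Q * P * Q)] at t3
    simp only [Matrix.mul_add, Matrix.trace_add, Matrix.trace_sub (tensorPow ρ n * (1 - P) + tensorPow ρ n * (1 - P) + (tensorPow ρ n * (1 - Q) + tensorPow ρ n * (1 - Q) + tensorPow ρ n * (1 - Q))),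
      Complex.add_re, Complex.sub_re] at t3
    unfold alphaErr
    linarith
  · have hσn : tensorPow σ n = cj (tensorPow V n) (fun x => ∏ i, s (x i)) := by
      conv_lhs => rw [hσe]
      rw [tp_cj]
    have e1 : betaErr σ n (Q * P * Q)
        = (cj (tensorPow V n) (fun x => fQ x * (∏ i, s (x i)) * fQ x) * P).trace.re := by
      unfold betaErr
      rw [← cj_mul (tp_unit hV1 n), ← cj_mul (tp_unit hV1 n), ← hQ, ← hσn,
        ← Matrix.mul_assoc, Matrix.trace_mul_comm]
      simp only [Matrix.mul_assoc]
    have e2 : betaErr σ n (Q * P * Q) ≤ Real.exp (n * (b + δ)) * P.trace.re := by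
      rw [e1]
      refine (cj_trace_mono (g := fun _ => Real.exp (n * (b + δ))) ?_ hPp).trans (le_of_eq ?_)
      · intro x
        simp only [hfQ]
        split_ifs with h
        · rw [one_mul, mul_one]
          refine le_trans (le_of_eq ?_) (Real.exp_le_exp.mpr h)
          rw [Real.exp_sum]
          exact Finset.prod_congr rfl fun i _ => (Real.exp_log (hspos _)).symm
        · simpa using (Real.exp_pos _).le
      · rw [cj_const (tp_unit2 hV2 n), Matrix.smul_mul, Matrix.trace_smul, smul_eq_mul,
          Complex.re_ofReal_mul, Matrix.one_mul]
    have e3 : P.trace.re ≤ Real.exp (n * (-a + δ)) := by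
      rw [hP, cj_trace (tp_unit hU1 n)]
      have : Real.exp (n * (-a + δ)) =
          ∑ x : Fin n → Fin d, Real.exp (n * (-a + δ)) * ∏ i, r (x i) := by
        rw [← Finset.mul_sum, sum_prod_pow, hrsum, one_pow, mul_one]
      rw [this]
      refine Finset.sum_le_sum fun x _ => ?_
      have hp : ∏ i, r (x i) = Real.exp (∑ i, Real.log (r (x i))) := by
        rw [Real.exp_sum]
        exact Finset.prod_congr rfl fun i _ => (Real.exp_log (hrpos _)).symm
      rw [hp, ← Real.exp_add]
      simp only [hfP]
      split_ifs with h
      · apply Real.one_le_exp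
        rw [Finset.sum_neg_distrib] at h
        linarith
      · exact (Real.exp_pos _).le
    refine e2.trans ((mul_le_mul_of_nonneg_left e3 (Real.exp_pos _).le).trans (le_of_eq ?_))
    rw [← Real.exp_add, hD]
    congr 1
    ring

/-- **Direct part of Stein's lemma.** For every `0 < ε < 1`,
`limsup_{n→∞} (1/n) log β*_n(ε) ≤ −D(ρ‖σ)`. -/
theorem stein_direct_part {d : ℕ} (hd : 0 < d) (ρ σ : Matrix (Fin d) (Fin d) ℂ)
    (hρ : IsDensity ρ) (hσ : IsDensity σ) (hρpd : ρ.PosDef) (hσpd : σ.PosDef)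
    (ε : ℝ) (hε0 : 0 < ε) (hε1 : ε < 1) :
    Filter.limsup (fun n : ℕ => (1 / (n : ℝ)) * Real.log (betaStar ρ σ n ε)) atTop
      ≤ -(relEnt ρ σ) := by
  obtain ⟨l, hl, hlow⟩ := betaErr_lower hρ hσpd
  have hone : ∀ n, IsTest (1 : Matrix (Fin n → Fin d) (Fin n → Fin d) ℂ) := fun n =>
    ⟨Matrix.PosSemidef.one, by rw [sub_self]; exact Matrix.PosSemidef.zero⟩
  have hbs : ∀ n, l ^ n * (1 - ε) ≤ betaStar ρ σ n ε := by
    intro n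
    refine le_csInf ⟨_, 1, hone n, ?_, rfl⟩ ?_
    · simp [alphaErr, hε0.le]
    · rintro _ ⟨A, hA, hα, rfl⟩
      exact hlow n ε A hA hα
  have hpos : ∀ n : ℕ, 0 < l ^ n * (1 - ε) := fun n => mul_pos (pow_pos hl n) (by linarith)
  have hcob : IsCoboundedUnder (· ≤ ·) atTop
      (fun n : ℕ => (1 / (n : ℝ)) * Real.log (betaStar ρ σ n ε)) := by
    refine isCoboundedUnder_le_of_eventually_le atTop (x := Real.log l + Real.log (1 - ε)) ?_
    filter_upwards [eventually_ge_atTop 1] with n hn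
    have hn' : (1 : ℝ) ≤ n := by exact_mod_cast hn
    have h1 := Real.log_le_log (hpos n) (hbs n)
    rw [Real.log_mul (pow_pos hl n).ne' (by linarith), Real.log_pow] at h1
    have h2 : Real.log (1 - ε) ≤ 0 := Real.log_nonpos (by linarith) (by linarith)
    rw [one_div, inv_mul_eq_div, le_div_iff₀ (by linarith)]
    nlinarith
  refine le_of_forall_pos_le_add fun δ hδ => ?_
  refine limsup_le_of_le hcob ?_
  filter_upwards [exists_test hρ hρpd hσpd ε hε0 (δ / 2) (by positivity), eventually_ge_atTop 1]
    with n hn hn1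
  obtain ⟨A, hA, hα, hβ⟩ := hn
  have hn' : (0 : ℝ) < n := by exact_mod_cast hn1
  have h1 : betaStar ρ σ n ε ≤ betaErr σ n A := by
    refine csInf_le ⟨l ^ n * (1 - ε), ?_⟩ ⟨A, hA, hα, rfl⟩
    rintro _ ⟨B, hB, hαB, rfl⟩
    exact hlow n ε B hB hαB
  have h2 := Real.log_le_log ((hpos n).trans_le (hbs n)) (h1.trans hβ)
  rw [Real.log_exp] at h2
  rw [one_div, inv_mul_eq_div, div_le_iff₀ hn']
  linarith

end
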